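/- Let Ω₁,...,Ω_n be holomorphic vector fields on a polydisk {|ξ_α| < ρ+ε} in C^d with coefficients bounded there, each of the special form Ω_j = β_j ∂/∂ξ_{k_j} with β_j holomorphic and bounded. Then there exist constants A, c such that for every function F holomorphic and bounded on the polydisk {|ξ_α| < ρ+ε} and every sequence j_1,...,j_p, one has sup_{|ξ_α|<ρ/2} |Ω_{j_1}...Ω_{j_p} F(ξ)| ≤ A · p! · c^p · sup_{|ξ_α|<ρ+ε} |F(ξ)|. -/

import Mathlib

open scoped BigOperators

namespace Stmt19

/-- The open polydisk `{|ξ_α| < r}` in `ℂ^d`. -/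
def polydisk (d : ℕ) (r : ℝ) : Set (Fin d → ℂ) := { ξ | ∀ α, ‖ξ α‖ < r }

/-- The first-order holomorphic differential operator `Ω = β ∂/∂ξ_k` applied to `F`. -/
noncomputable def Omega {d : ℕ} (β : (Fin d → ℂ) → ℂ) (k : Fin d)
    (F : (Fin d → ℂ) → ℂ) : (Fin d → ℂ) → ℂ :=
  fun ξ => β ξ * fderiv ℂ F ξ (Pi.single k 1)

/-- Iterated application `Ω_{j₁} Ω_{j₂} ⋯ Ω_{j_p} F` of the vector fields `Ω_j = β_j ∂/∂ξ_{k_j}`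
along a list `[j₁, …, j_p]`. -/
noncomputable def applyOps {d m : ℕ} (β : Fin m → (Fin d → ℂ) → ℂ) (k : Fin m → Fin d) :
    List (Fin m) → ((Fin d → ℂ) → ℂ) → ((Fin d → ℂ) → ℂ)
  | [], F => F
  | j :: l, F => Omega (β j) (k j) (applyOps β k l F)

/-- The Cauchy estimate for a directional derivative. -/
theorem norm_fderiv_apply_le {E : Type*} [NormedAddCommGroup E] [NormedSpace ℂ E]
    {f : E → ℂ} {x v : E} {r C : ℝ} (hr : 0 < r)
    (hd : ∀ t ∈ Metric.closedBall (0 : ℂ) r, DifferentiableAt ℂ f (x + t • v))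
    (hC : ∀ t ∈ Metric.sphere (0 : ℂ) r, ‖f (x + t • v)‖ ≤ C) :
    ‖fderiv ℂ f x v‖ ≤ C / r := by
  have hline : DifferentiableOn ℂ (fun t : ℂ => f (x + t • v)) (Metric.closedBall 0 r) :=
    fun t ht => ((hd t ht).comp t (by fun_prop)).differentiableWithinAt
  have hx : DifferentiableAt ℂ f x := by
    simpa using hd 0 (Metric.mem_closedBall_self hr.le)
  have hderiv : deriv (fun t : ℂ => f (x + t • v)) 0 = fderiv ℂ f x v :=
    hx.lineDeriv_eq_fderiv
  rw [← hderiv]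
  exact Complex.norm_deriv_le_of_forall_mem_sphere_norm_le hr
    (hline.mono Metric.closure_ball_subset_closedBall).diffContOnCl hC

/-- Directional derivatives of a holomorphic function of several variables are holomorphic. -/
theorem differentiableOn_fderiv_apply {E : Type*} [NormedAddCommGroup E] [NormedSpace ℂ E]
    [FiniteDimensional ℂ E] {f : E → ℂ} {U : Set E} (hU : IsOpen U)
    (hf : DifferentiableOn ℂ f U) (v : E) :
    DifferentiableOn ℂ (fun x => fderiv ℂ f x v) U := by
  intro x₀ hx₀
  refine DifferentiableAt.differentiableWithinAt ?_
  obtain ⟨R, hR, M, hRU, hM⟩ : ∃ R > 0, ∃ M : ℝ, Metric.ball x₀ R ⊆ U ∧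
      ∀ x ∈ Metric.ball x₀ R, ‖f x‖ ≤ M := by
    have hcont : ContinuousAt f x₀ := (hf.differentiableAt (hU.mem_nhds hx₀)).continuousAt
    have hev : ∀ᶠ x in nhds x₀, x ∈ U ∧ ‖f x‖ < ‖f x₀‖ + 1 :=
      Filter.Eventually.and (hU.mem_nhds hx₀) (hcont.norm.eventually_lt_const (lt_add_one _))
    obtain ⟨R, hR, h⟩ := Metric.eventually_nhds_iff_ball.mp hev
    exact ⟨R, hR, ‖f x₀‖ + 1, fun x hx => (h x hx).1, fun x hx => (h x hx).2.le⟩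
  have hfd : ∀ x ∈ Metric.ball x₀ R, DifferentiableAt ℂ f x := fun x hx =>
    hf.differentiableAt (hU.mem_nhds (hRU hx))
  have hK : ∀ x ∈ Metric.ball x₀ (R / 2), ‖fderiv ℂ f x‖ ≤ 2 * M / (R / 2) := by
    intro x hx
    have hsub : Metric.ball x (R / 2) ⊆ Metric.ball x₀ R :=
      Metric.ball_subset_ball' (by rw [Metric.mem_ball] at hx; linarith)
    refine Complex.norm_fderiv_le_div_of_mapsTo_ball
      (fun y hy => (hfd y (hsub hy)).differentiableWithinAt) (fun y hy => ?_) (half_pos hR)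
    rw [mem_closedBall_iff_norm]
    linarith [norm_sub_le (f y) (f x), hM y (hsub hy),
      hM x (hsub (Metric.mem_ball_self (half_pos hR)))]
  set r : ℝ := R / (4 * (‖v‖ + 1)) with hr_def
  have hr : 0 < r := by positivity
  have hrv : r * ‖v‖ ≤ R / 4 := by
    have : r * (‖v‖ + 1) = R / 4 := by rw [hr_def]; field_simp
    nlinarith
  have hshift : ∀ x ∈ Metric.ball x₀ (R / 4), ∀ t ∈ Metric.closedBall (0 : ℂ) r,
      x + t • v ∈ Metric.ball x₀ (R / 2) := by
    intro x hx t ht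
    rw [mem_ball_iff_norm] at hx ⊢
    rw [mem_closedBall_zero_iff] at ht
    have h1 : ‖t • v‖ ≤ r * ‖v‖ := by rw [norm_smul]; gcongr
    calc ‖x + t • v - x₀‖ = ‖(x - x₀) + t • v‖ := by congr 1; abel
      _ ≤ ‖x - x₀‖ + ‖t • v‖ := norm_add_le _ _
      _ < R / 2 := by linarith
  have hhalf : Metric.ball x₀ (R / 2) ⊆ Metric.ball x₀ R :=
    Metric.ball_subset_ball (by linarith)
  have hcircle : ∀ θ, circleMap (0 : ℂ) r θ ∈ Metric.closedBall (0 : ℂ) r := fun θ =>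
    circleMap_mem_closedBall _ hr.le θ
  set w : ℝ → ℂ := fun θ => deriv (circleMap 0 r) θ * (1 / (circleMap 0 r θ) ^ 2) with hw_def
  have hw_cont : Continuous w := by
    have hne : ∀ θ, circleMap (0 : ℂ) r θ ^ 2 ≠ 0 := fun θ =>
      pow_ne_zero 2 (circleMap_ne_center hr.ne')
    simp only [hw_def, deriv_circleMap]
    exact ((continuous_circleMap 0 r).mul continuous_const).mul
      (continuous_const.div ((continuous_circleMap 0 r).pow 2) hne)
  have hw_norm : ∀ θ, ‖w θ‖ = r⁻¹ := by
    intro θ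
    simp [hw_def, abs_of_pos hr]
    field_simp
  have hcauchy : ∀ x ∈ Metric.ball x₀ (R / 4),
      (2 * Real.pi * Complex.I)⁻¹ *
        ∫ θ in (0 : ℝ)..2 * Real.pi, w θ * f (x + circleMap 0 r θ • v) = fderiv ℂ f x v := by
    intro x hx
    have hline : DifferentiableOn ℂ (fun t : ℂ => f (x + t • v)) (Metric.closedBall 0 r) :=
      fun t ht => ((hfd _ (hhalf (hshift x hx t ht))).comp t
        (by fun_prop)).differentiableWithinAt
    have hxd : DifferentiableAt ℂ f x :=
      hfd x (Metric.ball_subset_ball (by linarith) hx)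
    have hderiv : deriv (fun t : ℂ => f (x + t • v)) 0 = fderiv ℂ f x v :=
      hxd.lineDeriv_eq_fderiv
    have h := hline.deriv_eq_smul_circleIntegral hr
    rw [hderiv, circleIntegral] at h
    simp only [sub_zero, smul_eq_mul] at h
    rw [inv_mul_eq_iff_eq_mul₀ Complex.two_pi_I_ne_zero, ← h]
    simp only [hw_def, mul_assoc]
  have hcont : ∀ x ∈ Metric.ball x₀ (R / 4),
      Continuous fun θ => w θ * f (x + circleMap 0 r θ • v) := by
    intro x hx
    refine hw_cont.mul (continuous_iff_continuousAt.mpr fun θ => ?_)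
    exact ContinuousAt.comp (f := fun θ => x + circleMap 0 r θ • v)
      (hfd _ (hhalf (hshift x hx _ (hcircle θ)))).continuousAt
      (continuous_const.add ((continuous_circleMap 0 r).smul continuous_const)).continuousAt
  have hnhds : Metric.ball x₀ (R / 4) ∈ nhds x₀ := Metric.ball_mem_nhds _ (by positivity)
  have hmeas : MeasureTheory.AEStronglyMeasurable
      (fun θ => w θ • fderiv ℂ f (x₀ + circleMap 0 r θ • v))
      (MeasureTheory.volume.restrict (Set.uIoc 0 (2 * Real.pi))) := by
    borelize E
    have : ProperSpace E := FiniteDimensional.proper ℂ E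
    have h1 : Measurable fun θ => fderiv ℂ f (x₀ + circleMap 0 r θ • v) :=
      (measurable_fderiv ℂ f).comp
        (continuous_const.add ((continuous_circleMap 0 r).smul continuous_const)).measurable
    exact hw_cont.aestronglyMeasurable.smul h1.aestronglyMeasurable
  have hint := intervalIntegral.hasFDerivAt_integral_of_dominated_of_fderiv_le
    (μ := MeasureTheory.volume) (a := 0) (b := 2 * Real.pi)
    (F := fun x θ => w θ * f (x + circleMap 0 r θ • v))
    (F' := fun x θ => w θ • fderiv ℂ f (x + circleMap 0 r θ • v))
    (bound := fun _ => r⁻¹ * (2 * M / (R / 2))) hnhds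
    (Filter.mem_of_superset hnhds fun x hx => (hcont x hx).aestronglyMeasurable)
    ((hcont x₀ (mem_of_mem_nhds hnhds)).intervalIntegrable _ _) hmeas
    (Filter.Eventually.of_forall fun θ _ x hx => by
      rw [norm_smul, hw_norm]
      gcongr
      exact hK _ (hshift x hx _ (hcircle θ)))
    intervalIntegrable_const
    (Filter.Eventually.of_forall fun θ _ x hx => by
      have h1 := (hfd _ (hhalf (hshift x hx _ (hcircle θ)))).hasFDerivAt
      exact ((hasFDerivAt_comp_add_right _).mpr h1).const_mul (w θ))
  refine (hint.differentiableAt.const_mul (2 * Real.pi * Complex.I)⁻¹).congr_of_eventuallyEq ?_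
  exact Filter.mem_of_superset hnhds fun x hx => (hcauchy x hx).symm

theorem isOpen_polydisk (d : ℕ) (r : ℝ) : IsOpen (polydisk d r) := by
  simp only [polydisk, Set.ofPred_forall]
  exact isOpen_iInter_of_finite fun α =>
    isOpen_lt (continuous_apply α).norm continuous_const

theorem polydisk_subset {d : ℕ} {r s : ℝ} (h : r ≤ s) : polydisk d r ⊆ polydisk d s :=
  fun _ hξ α => (hξ α).trans_le h

theorem add_smul_single_mem_polydisk {d : ℕ} {r δ : ℝ} {ξ : Fin d → ℂ}
    (hξ : ξ ∈ polydisk d (r - δ)) (i : Fin d) {t : ℂ} (ht : ‖t‖ ≤ δ) :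
    ξ + t • Pi.single i 1 ∈ polydisk d r := by
  intro α
  have h1 : ‖(t • (Pi.single i 1 : Fin d → ℂ)) α‖ ≤ ‖t‖ := by
    by_cases h : α = i
    · subst h; simp
    · simp [h]
  have h2 := norm_add_le (ξ α) ((t • (Pi.single i 1 : Fin d → ℂ)) α)
  have h3 := hξ α
  rw [Pi.add_apply]
  linarith

theorem differentiableOn_applyOps {d m : ℕ} {R : ℝ} {β : Fin m → (Fin d → ℂ) → ℂ}
    {k : Fin m → Fin d} (hβ : ∀ j, DifferentiableOn ℂ (β j) (polydisk d R))
    {F : (Fin d → ℂ) → ℂ} (hF : DifferentiableOn ℂ F (polydisk d R)) (l : List (Fin m)) :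
    DifferentiableOn ℂ (applyOps β k l F) (polydisk d R) := by
  induction l with
  | nil => exact hF
  | cons j l ih => exact (hβ j).mul (differentiableOn_fderiv_apply (isOpen_polydisk d R) ih _)

/-- Each application of an operator costs a factor `B / δ` and shrinks the polydisk by `δ`. -/
theorem norm_applyOps_le {d m : ℕ} {R δ B M : ℝ} (hδ : 0 < δ) (hB : 0 ≤ B)
    {β : Fin m → (Fin d → ℂ) → ℂ} {k : Fin m → Fin d}
    (hβ : ∀ j, DifferentiableOn ℂ (β j) (polydisk d R))
    (hβB : ∀ j, ∀ ξ ∈ polydisk d R, ‖β j ξ‖ ≤ B)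
    {F : (Fin d → ℂ) → ℂ} (hF : DifferentiableOn ℂ F (polydisk d R))
    (hFM : ∀ ξ ∈ polydisk d R, ‖F ξ‖ ≤ M) (l : List (Fin m)) :
    ∀ ξ ∈ polydisk d (R - l.length * δ), ‖applyOps β k l F ξ‖ ≤ (B / δ) ^ l.length * M := by
  induction l with
  | nil => simpa [applyOps] using hFM
  | cons j l ih =>
    intro ξ hξ
    have hlen : 0 ≤ l.length * δ := by positivity
    rw [List.length_cons, Nat.cast_succ,
      show R - ((l.length : ℝ) + 1) * δ = R - l.length * δ - δ by ring] at hξ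
    have hmem : ∀ t : ℂ, ‖t‖ ≤ δ →
        ξ + t • Pi.single (k j) 1 ∈ polydisk d (R - l.length * δ) := fun t ht =>
      add_smul_single_mem_polydisk hξ (k j) ht
    have hderiv : ‖fderiv ℂ (applyOps β k l F) ξ (Pi.single (k j) 1)‖ ≤
        (B / δ) ^ l.length * M / δ := by
      refine norm_fderiv_apply_le hδ (fun t ht => ?_) (fun t ht => ih _ (hmem t ?_))
      · refine (differentiableOn_applyOps hβ hF l).differentiableAt
          ((isOpen_polydisk d R).mem_nhds ?_)
        exact polydisk_subset (by linarith) (hmem t (mem_closedBall_zero_iff.mp ht))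
      · exact (mem_sphere_zero_iff_norm.mp ht).le
    calc ‖applyOps β k (j :: l) F ξ‖
        = ‖β j ξ‖ * ‖fderiv ℂ (applyOps β k l F) ξ (Pi.single (k j) 1)‖ := norm_mul _ _
      _ ≤ B * ((B / δ) ^ l.length * M / δ) := by
          gcongr
          exact hβB j ξ (polydisk_subset (by linarith) hξ)
      _ = (B / δ) ^ (j :: l).length * M := by rw [List.length_cons, pow_succ]; ring

theorem pow_self_le_factorial_mul_exp_pow (n : ℕ) :
    (n : ℝ) ^ n ≤ n.factorial * Real.exp 1 ^ n := by
  have h := Real.pow_div_factorial_le_exp (x := n) n.cast_nonneg n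
  rw [div_le_iff₀ (by positivity)] at h
  rwa [← Real.exp_nat_mul, mul_one, mul_comm]

/-- Cauchy-type estimate for iterated first-order holomorphic differential operators.
Let `Ω_1, …, Ω_m` be holomorphic vector fields on the polydisk `{|ξ_α| < ρ + ε}` in `ℂ^d`,
each of the special form `Ω_j = β_j ∂/∂ξ_{k_j}` with `β_j` holomorphic and bounded there.
Then there are constants `A, c` such that for every `F` holomorphic and bounded on the
polydisk and every sequence `j_1, …, j_p`,
`sup_{|ξ_α| < ρ/2} |Ω_{j₁}⋯Ω_{j_p} F(ξ)| ≤ A · p! · c^p · sup_{|ξ_α| < ρ+ε} |F(ξ)|`. -/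
theorem iterated_vector_field_estimate
    (d m : ℕ) (ρ ε : ℝ) (hρ : 0 < ρ) (hε : 0 < ε)
    (β : Fin m → (Fin d → ℂ) → ℂ) (k : Fin m → Fin d)
    (hβdiff : ∀ j, DifferentiableOn ℂ (β j) (polydisk d (ρ + ε)))
    (hβbdd : ∀ j, ∃ B : ℝ, ∀ ξ ∈ polydisk d (ρ + ε), ‖β j ξ‖ ≤ B) :
    ∃ A c : ℝ, ∀ (F : (Fin d → ℂ) → ℂ) (MF : ℝ),
      DifferentiableOn ℂ F (polydisk d (ρ + ε)) →
      (∀ ξ ∈ polydisk d (ρ + ε), ‖F ξ‖ ≤ MF) →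
      ∀ (l : List (Fin m)), ∀ ξ ∈ polydisk d (ρ / 2),
        ‖applyOps β k l F ξ‖ ≤ A * l.length.factorial * c ^ l.length * MF := by
  choose b hb using hβbdd
  set B : ℝ := ∑ j, |b j|
  have hB : 0 ≤ B := Finset.sum_nonneg fun j _ => abs_nonneg _
  have hβB : ∀ j, ∀ ξ ∈ polydisk d (ρ + ε), ‖β j ξ‖ ≤ B := fun j ξ hξ =>
    (hb j ξ hξ).trans <| (le_abs_self _).trans <|
      Finset.single_le_sum (f := fun j => |b j|) (fun i _ => abs_nonneg _) (Finset.mem_univ j)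
  refine ⟨1, 2 * B / ρ * Real.exp 1, fun F MF hF hFM l ξ hξ => ?_⟩
  have hM : 0 ≤ MF := (norm_nonneg _).trans (hFM 0 fun α => by simp; positivity)
  rcases l.length.eq_zero_or_pos with hl | hl
  · obtain rfl := List.length_eq_zero_iff.mp hl
    simpa [applyOps] using hFM ξ (polydisk_subset (by linarith) hξ)
  have hl' : (0 : ℝ) < l.length := by exact_mod_cast hl
  have hδ : 0 < ρ / (2 * l.length) := by positivity
  have hrad : ρ / 2 ≤ ρ + ε - l.length * (ρ / (2 * l.length)) := by
    have : l.length * (ρ / (2 * l.length)) = ρ / 2 := by field_simp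
    linarith
  calc ‖applyOps β k l F ξ‖
      ≤ (B / (ρ / (2 * l.length))) ^ l.length * MF :=
        norm_applyOps_le hδ hB hβdiff hβB hF hFM l ξ (polydisk_subset hrad hξ)
    _ = (2 * B / ρ) ^ l.length * (l.length : ℝ) ^ l.length * MF := by
        rw [← mul_pow]; congr 2; field_simp
    _ ≤ (2 * B / ρ) ^ l.length * (l.length.factorial * Real.exp 1 ^ l.length) * MF := by
        gcongr
        exact pow_self_le_factorial_mul_exp_pow _
    _ = 1 * l.length.factorial * (2 * B / ρ * Real.exp 1) ^ l.length * MF := by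
        rw [mul_pow]; ring

end Stmt19
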